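/- If γ₁, γ₂ = 0, γ₃ = 0, β = 0, and μ is an invariant probability measure of the stochastic Lorenz system with γ₁ > 0 whose (y,z)-marginal a.s. satisfies y = 0, then z is constant in time (z_t = z₀), and x is a stationary solution of the Ornstein–Uhlenbeck equation dx = −σx dt + √(2γ₁)dB₁; hence the unique invariant probability measure concentrates as μ = ν_{0,γ₁/σ} × δ₀ × δ_ρ, where ν_{m,s} is the Gaussian measure with mean m and variance s, and δ_a is the Dirac mass at a. -/

import Mathlib

open MeasureTheory ProbabilityTheory

/-- Generator of the stochastic Lorenz system with `β = 0`, `γ₂ = γ₃ = 0`,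
acting on functions of `(x,y,z) ∈ ℝ × ℝ × ℝ`:
`L f = σ(y−x)∂ₓf + (x(ρ−z)−y)∂_y f + xy ∂_z f + γ₁∂ₓ²f`. -/
noncomputable def lorenzGenX (σ ρ γ1 : ℝ) (f : ℝ × ℝ × ℝ → ℝ)
    (p : ℝ × ℝ × ℝ) : ℝ :=
  σ * (p.2.1 - p.1) * deriv (fun t => f (t, p.2.1, p.2.2)) p.1 +
    (p.1 * (ρ - p.2.2) - p.2.1) * deriv (fun t => f (p.1, t, p.2.2)) p.2.1 +
    p.1 * p.2.1 * deriv (fun t => f (p.1, p.2.1, t)) p.2.2 +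
    γ1 * deriv (fun t => deriv (fun s => f (s, p.2.1, p.2.2)) t) p.1

section TensorProducts

variable {a b c : ℝ → ℝ}

lemma lorenzGenX_tensor (σ ρ γ1 : ℝ) (a b c : ℝ → ℝ) (p : ℝ × ℝ × ℝ) :
    lorenzGenX σ ρ γ1 (fun q => a q.1 * b q.2.1 * c q.2.2) p =
      σ * (p.2.1 - p.1) * (deriv a p.1 * b p.2.1 * c p.2.2) +
      (p.1 * (ρ - p.2.2) - p.2.1) * (a p.1 * deriv b p.2.1 * c p.2.2) +
      p.1 * p.2.1 * (a p.1 * b p.2.1 * deriv c p.2.2) +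
      γ1 * (deriv (deriv a) p.1 * b p.2.1 * c p.2.2) := by
  simp [lorenzGenX, deriv_mul_const_field, deriv_const_mul_field]

lemma contDiff_tensor {n : WithTop ℕ∞} (ha : ContDiff ℝ n a) (hb : ContDiff ℝ n b)
    (hc : ContDiff ℝ n c) :
    ContDiff ℝ n (fun q : ℝ × ℝ × ℝ => a q.1 * b q.2.1 * c q.2.2) :=
  ((ha.comp contDiff_fst).mul (hb.comp (contDiff_fst.comp contDiff_snd))).mul
    (hc.comp (contDiff_snd.comp contDiff_snd))

lemma hasCompactSupport_tensor (ha : HasCompactSupport a) (hb : HasCompactSupport b)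
    (hc : HasCompactSupport c) :
    HasCompactSupport (fun q : ℝ × ℝ × ℝ => a q.1 * b q.2.1 * c q.2.2) := by
  refine HasCompactSupport.intro (ha.isCompact.prod (hb.isCompact.prod hc.isCompact)) ?_
  rintro ⟨x, y, z⟩ h
  by_contra hne
  simp only [mul_eq_zero, not_or] at hne
  exact h ⟨subset_tsupport _ hne.1.1, subset_tsupport _ hne.1.2, subset_tsupport _ hne.2⟩

end TensorProducts

lemma contDiff_two_of_hasDerivAt {φ g g' : ℝ → ℝ} (hφ : ∀ x, HasDerivAt φ (g x) x)
    (hg : ∀ x, HasDerivAt g (g' x) x) (hg' : Continuous g') : ContDiff ℝ 2 φ := by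
  have h1 : deriv φ = g := funext fun x => (hφ x).deriv
  have h2 : deriv g = g' := funext fun x => (hg x).deriv
  rw [show (2 : WithTop ℕ∞) = 1 + 1 from one_add_one_eq_two.symm, contDiff_succ_iff_deriv, h1,
    contDiff_one_iff_deriv, h2]
  exact ⟨fun x => (hφ x).differentiableAt, by simp, fun x => (hg x).differentiableAt, hg'⟩

lemma hasDerivAt_gaussianPDFReal_zero (v : NNReal) (hv : v ≠ 0) (x : ℝ) :
    HasDerivAt (gaussianPDFReal 0 v) (-(x / v) * gaussianPDFReal 0 v x) x := by
  have hv' : (v : ℝ) ≠ 0 := by exact_mod_cast hv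
  rw [gaussianPDFReal_def]
  have h : HasDerivAt (fun x : ℝ => -(x - 0) ^ 2 / (2 * (v : ℝ))) (-(x / v)) x := by
    have := ((((hasDerivAt_id x).sub_const 0).pow 2).neg).div_const (2 * (v : ℝ))
    convert! this using 1
    simp
    field_simp
  convert! (h.exp.const_mul _) using 1
  ring

/-- A compactly supported solution of Stein's equation for a centred Gaussian. -/
lemma exists_hasCompactSupport_stein_solution (v : NNReal) (hv : v ≠ 0) {h : ℝ → ℝ}
    (hc : Continuous h) (hs : HasCompactSupport h) (h0 : ∫ x, h x ∂gaussianReal 0 v = 0) :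
    ∃ g g' : ℝ → ℝ, Continuous g' ∧ HasCompactSupport g ∧ (∀ x, HasDerivAt g (g' x) x) ∧
      ∀ x, v * g' x - x * g x = h x := by
  have hv' : (v : ℝ) ≠ 0 := by exact_mod_cast hv
  set w := gaussianPDFReal 0 v with hw
  have hwpos : ∀ x, 0 < w x := fun x => gaussianPDFReal_pos 0 v x hv
  have hwd : ∀ x, HasDerivAt w (-(x / v) * w x) x := hasDerivAt_gaussianPDFReal_zero v hv
  have hwc : Continuous w := continuous_iff_continuousAt.2 fun x => (hwd x).continuousAt
  have hwh : Continuous fun x => w x * h x := hwc.mul hc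
  rw [integral_gaussianReal_eq_integral_smul hv] at h0
  simp only [smul_eq_mul, ← hw] at h0
  obtain ⟨K, hK⟩ := hs.isCompact.isBounded.subset_ball 0
  have hz : ∀ x, K ≤ |x| → h x = 0 := by
    intro x hx
    by_contra hne
    have := hK (subset_tsupport _ hne)
    simp only [Metric.mem_ball, dist_zero_right, Real.norm_eq_abs] at this
    linarith
  set G : ℝ → ℝ := fun x => ∫ u in (-K)..x, w u * h u with hG
  have hGd : ∀ x, HasDerivAt G (w x * h x) x := fun x =>
    (hwh.integral_hasStrictDerivAt (-K) x).hasDerivAt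
  have hGc : Continuous G := continuous_iff_continuousAt.2 fun x => (hGd x).continuousAt
  have hgd : ∀ x, HasDerivAt (fun x => G x / (v * w x))
      (h x / v + x / v * (G x / (v * w x))) x := by
    intro x
    have hne := (hwpos x).ne'
    convert! (hGd x).div ((hwd x).const_mul (v : ℝ)) (mul_ne_zero hv' hne) using 1
    field_simp
    ring
  refine ⟨fun x => G x / (v * w x), fun x => h x / v + x / v * (G x / (v * w x)), ?_, ?_, hgd, ?_⟩
  · have : Continuous fun x => G x / (v * w x) :=
      hGc.div (continuous_const.mul hwc) fun x => mul_ne_zero hv' (hwpos x).ne'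
    fun_prop
  · refine HasCompactSupport.intro (isCompact_Icc (a := -K) (b := K)) fun x hx => ?_
    have : G x = 0 := by
      rw [Set.mem_Icc, not_and_or, not_le, not_le] at hx
      rcases hx with hx | hx
      · refine (intervalIntegral.integral_congr (g := fun _ => 0) fun u hu => ?_).trans (by simp)
        rw [Set.uIcc_of_ge hx.le] at hu
        have : h u = 0 := hz u (by linarith [neg_le_abs u, hu.2])
        simp [this]
      · rw [← h0]
        refine intervalIntegral.integral_eq_integral_of_support_subset fun u hu => ?_
        have hne : h u ≠ 0 := fun h' => hu (by simp [h'])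
        have := lt_of_not_ge fun h' => hne (hz u h')
        rw [abs_lt] at this
        exact ⟨this.1, by linarith⟩
    simp [this]
  · intro x
    field_simp
    ring

lemma exists_bounded_primitive {g : ℝ → ℝ} (hc : Continuous g) (hs : HasCompactSupport g) :
    ∃ φ : ℝ → ℝ, (∀ x, HasDerivAt φ (g x) x) ∧ ∃ C, ∀ x, ‖φ x‖ ≤ C := by
  refine ⟨fun x => ∫ u in (0 : ℝ)..x, g u, fun x => (hc.integral_hasStrictDerivAt 0 x).hasDerivAt,
    ∫ u, ‖g u‖, fun x => intervalIntegral.norm_integral_le_integral_norm_uIoc.trans ?_⟩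
  exact setIntegral_le_integral (hc.integrable_of_hasCompactSupport hs).norm
    (Filter.Eventually.of_forall fun _ => norm_nonneg _)

lemma hasCompactSupport_comp_mul_left {f : ℝ → ℝ} (hf : HasCompactSupport f) {e : ℝ}
    (he : e ≠ 0) : HasCompactSupport fun x => f (e * x) := by
  simpa only [smul_eq_mul] using hf.comp_smul he

lemma tendsto_natCast_add_one_inv :
    Filter.Tendsto (fun n : ℕ => ((n : ℝ) + 1)⁻¹) Filter.atTop (nhds 0) := by
  simpa only [one_div] using tendsto_one_div_add_atTop_nhds_zero_nat (𝕜 := ℝ)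

lemma exists_cutoff : ∃ η : ℝ → ℝ, ContDiff ℝ 2 η ∧ HasCompactSupport η ∧ (∀ x, 0 ≤ η x) ∧
    (∀ x, η x ≤ 1) ∧ η =ᶠ[nhds 0] 1 :=
  let η : ContDiffBump (0 : ℝ) := default
  ⟨η, η.contDiff, η.hasCompactSupport, fun _ => η.nonneg, fun _ => η.le_one, η.eventuallyEq_one⟩

section InfinitesimallyInvariant

variable {σ ρ γ1 : ℝ} {μ : Measure (ℝ × ℝ × ℝ)}

lemma integral_lorenzGenX_tensor_eq_zero
    (hinv : ∀ f : ℝ × ℝ × ℝ → ℝ, ContDiff ℝ 2 f → HasCompactSupport f →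
      ∫ p, lorenzGenX σ ρ γ1 f p ∂μ = 0)
    (hy : ∀ᵐ p : ℝ × ℝ × ℝ ∂μ, p.2.1 = 0) {a b c : ℝ → ℝ}
    (ha : ContDiff ℝ 2 a) (hb : ContDiff ℝ 2 b) (hc : ContDiff ℝ 2 c)
    (ha' : HasCompactSupport a) (hb' : HasCompactSupport b) (hc' : HasCompactSupport c) :
    ∫ p, ((γ1 * deriv (deriv a) p.1 - σ * p.1 * deriv a p.1) * b 0 * c p.2.2 +
      p.1 * (ρ - p.2.2) * (a p.1 * deriv b 0 * c p.2.2)) ∂μ = 0 := by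
  refine Eq.trans (integral_congr_ae ?_) (hinv (fun q => a q.1 * b q.2.1 * c q.2.2)
    (contDiff_tensor ha hb hc) (hasCompactSupport_tensor ha' hb' hc'))
  filter_upwards [hy] with p hp
  rw [lorenzGenX_tensor, hp]
  ring

/-- Infinitesimal invariance extends from compactly supported functions of `x` to bounded
functions of `x` with compactly supported derivative. -/
lemma integral_ou_generator_eq_zero [IsProbabilityMeasure μ]
    (hinv : ∀ f : ℝ × ℝ × ℝ → ℝ, ContDiff ℝ 2 f → HasCompactSupport f →
      ∫ p, lorenzGenX σ ρ γ1 f p ∂μ = 0)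
    (hy : ∀ᵐ p : ℝ × ℝ × ℝ ∂μ, p.2.1 = 0)
    {φ g g' : ℝ → ℝ} (hφ : ∀ x, HasDerivAt φ (g x) x) (hg : ∀ x, HasDerivAt g (g' x) x)
    (hg' : Continuous g') (hgs : HasCompactSupport g) {C : ℝ} (hC : ∀ x, ‖φ x‖ ≤ C) :
    ∫ p, (γ1 * g' p.1 - σ * p.1 * g p.1) ∂μ = 0 := by
  obtain ⟨η, hηC, hηs, hηnn, hηle, hηev⟩ := exists_cutoff
  set η1 := deriv η with hη1
  set η2 := deriv η1 with hη2
  have hη1C : ContDiff ℝ 1 η1 := by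
    have h := hηC
    rw [show (2 : WithTop ℕ∞) = 1 + 1 from one_add_one_eq_two.symm, contDiff_succ_iff_deriv] at h
    exact h.2.2
  have hηd : ∀ x, HasDerivAt η (η1 x) x := fun x =>
    (hηC.differentiable (by simp) x).hasDerivAt
  have hη1d : ∀ x, HasDerivAt η1 (η2 x) x := fun x =>
    (hη1C.differentiable (by simp) x).hasDerivAt
  have hη1c : Continuous η1 := hη1C.continuous
  have hη2c : Continuous η2 := (contDiff_one_iff_deriv.1 hη1C).2
  have hηc : Continuous η := hηC.continuous
  have hη1s : HasCompactSupport η1 := hηs.deriv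
  have hη2s : HasCompactSupport η2 := hη1s.deriv
  have hη0 : η 0 = 1 := hηev.eq_of_nhds
  have hη10 : η1 0 = 0 := by
    rw [hη1, hηev.deriv_eq]
    exact deriv_const _ _
  have hφc : Continuous φ := continuous_iff_continuousAt.2 fun x => (hφ x).continuousAt
  have hgc : Continuous g := continuous_iff_continuousAt.2 fun x => (hg x).continuousAt
  have hg's : HasCompactSupport g' := by
    rw [show g' = deriv g from funext fun x => (hg x).deriv.symm]
    exact hgs.deriv
  let F : ℝ → ℝ × ℝ × ℝ → ℝ := fun e p =>
    η (e * p.2.2) * (η (e * p.1) * (γ1 * g' p.1 - σ * p.1 * g p.1) +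
      2 * γ1 * g p.1 * (e * η1 (e * p.1)) +
      φ p.1 * (γ1 * e ^ 2 * η2 (e * p.1) - σ * ((e * p.1) * η1 (e * p.1))))
  have hFint : ∀ e, e ≠ 0 → ∫ p, F e p ∂μ = 0 := by
    intro e he
    have hsc : ∀ x, HasDerivAt (fun s : ℝ => e * s) e x := fun x => by
      simpa using (hasDerivAt_id x).const_mul e
    have ha : ∀ x, HasDerivAt (fun s => φ s * η (e * s))
        (g x * η (e * x) + φ x * (η1 (e * x) * e)) x := fun x =>
      (hφ x).mul ((hηd (e * x)).comp x (hsc x))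
    have ha' : ∀ x, HasDerivAt (fun x => g x * η (e * x) + φ x * (η1 (e * x) * e))
        ((g' x * η (e * x) + g x * (η1 (e * x) * e)) +
          (g x * (η1 (e * x) * e) + φ x * (η2 (e * x) * e * e))) x := fun x =>
      ((hg x).mul ((hηd (e * x)).comp x (hsc x))).add
        ((hφ x).mul (((hη1d (e * x)).comp x (hsc x)).mul_const e))
    have hda := funext fun x => (ha x).deriv
    have hda' := funext fun x => (ha' x).deriv
    have hsupp := hasCompactSupport_comp_mul_left hηs he
    have hscale : ContDiff ℝ 2 fun x => η (e * x) := hηC.comp (contDiff_const.mul contDiff_id)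
    have hsupp' : HasCompactSupport fun s => φ s * η (e * s) := hsupp.mul_left
    have := integral_lorenzGenX_tensor_eq_zero hinv hy
      (contDiff_two_of_hasDerivAt ha ha' (by fun_prop)) hηC hscale hsupp' hηs hsupp
    rw [← this, hda, hda', ← hη1, hη10, hη0]
    congr 1 with p
    simp only [F]
    ring
  obtain ⟨C1, hC1⟩ := hη1c.bounded_above_of_compact_support hη1s
  obtain ⟨C2, hC2⟩ := hη2c.bounded_above_of_compact_support hη2s
  obtain ⟨C3, hC3⟩ := (continuous_id.mul hη1c).bounded_above_of_compact_support
    (hη1s.mul_left (f := id))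
  obtain ⟨C4, hC4⟩ := hgc.bounded_above_of_compact_support hgs
  obtain ⟨C5, hC5⟩ := (show Continuous (fun x => γ1 * g' x - σ * x * g x) by
    fun_prop).bounded_above_of_compact_support (hg's.mul_left.sub hgs.mul_left)
  have hlim : Filter.Tendsto (fun n : ℕ => ∫ p, F ((n : ℝ) + 1)⁻¹ p ∂μ) Filter.atTop
      (nhds (∫ p, (γ1 * g' p.1 - σ * p.1 * g p.1) ∂μ)) := by
    refine tendsto_integral_of_dominated_convergence
      (fun _ => 1 * (1 * C5 + 2 * |γ1| * C4 * (1 * C1) + C * (|γ1| * 1 * C2 + |σ| * C3)))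
      (fun n => ?_) (integrable_const _) (fun n => Filter.Eventually.of_forall fun p => ?_)
      (Filter.Eventually.of_forall fun p => ?_)
    · exact Continuous.aestronglyMeasurable (by fun_prop)
    · set e : ℝ := ((n : ℝ) + 1)⁻¹ with he
      have he0 : 0 ≤ e := by positivity
      have he1 : e ≤ 1 := inv_le_one_of_one_le₀ (by linarith [n.cast_nonneg (α := ℝ)])
      have hη' : ∀ x, |η x| ≤ 1 := fun x => by rw [abs_of_nonneg (hηnn _)]; exact hηle _
      have h3 : |e * p.1 * η1 (e * p.1)| ≤ C3 := hC3 (e * p.1)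
      have h1 := hC1 (e * p.1)
      have h2 := hC2 (e * p.1)
      have h4 := hC4 p.1
      have h5 := hC5 p.1
      have hC' := hC p.1
      simp only [Real.norm_eq_abs] at h1 h2 h4 h5 hC' ⊢
      have p1 := (abs_nonneg _).trans h1
      have p2 := (abs_nonneg _).trans h2
      have p3 := (abs_nonneg _).trans h3
      have p4 := (abs_nonneg _).trans h4
      have pC := (abs_nonneg _).trans hC'
      have he2 : |e ^ 2| ≤ 1 := by
        rw [abs_of_nonneg (by positivity)]
        exact pow_le_one₀ he0 he1
      have he' : |e| ≤ 1 := by rwa [abs_of_nonneg he0]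
      have hA : |η (e * p.1) * (γ1 * g' p.1 - σ * p.1 * g p.1)| ≤ 1 * C5 := by
        rw [abs_mul]
        exact mul_le_mul (hη' _) h5 (abs_nonneg _) zero_le_one
      have hB : |2 * γ1 * g p.1 * (e * η1 (e * p.1))| ≤ 2 * |γ1| * C4 * (1 * C1) := by
        simp only [abs_mul, abs_two]
        gcongr
      have hD : |γ1 * e ^ 2 * η2 (e * p.1) - σ * ((e * p.1) * η1 (e * p.1))| ≤
          |γ1| * 1 * C2 + |σ| * C3 := by
        refine (abs_sub _ _).trans (add_le_add ?_ ?_)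
        · rw [abs_mul, abs_mul]
          gcongr
        · rw [abs_mul]
          gcongr
      simp only [F]
      rw [abs_mul]
      refine mul_le_mul (hη' _) ?_ (abs_nonneg _) zero_le_one
      refine (abs_add_three _ _ _).trans (add_le_add (add_le_add hA hB) ?_)
      rw [abs_mul]
      exact mul_le_mul hC' hD (abs_nonneg _) pC
    · have hcont : Continuous fun e => F e p := by fun_prop
      have h0 : F 0 p = γ1 * g' p.1 - σ * p.1 * g p.1 := by simp [F, hη0]
      rw [← h0]
      exact (hcont.tendsto 0).comp tendsto_natCast_add_one_inv
  refine tendsto_nhds_unique hlim ?_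
  simp only [fun n : ℕ => hFint ((n : ℝ) + 1)⁻¹ (by positivity), tendsto_const_nhds]

/-- The `x`-marginal is the stationary law of the Ornstein–Uhlenbeck equation. -/
lemma map_fst_eq_gaussianReal [IsProbabilityMeasure μ] (hσ : 0 < σ) (hγ1 : 0 < γ1)
    (hinv : ∀ f : ℝ × ℝ × ℝ → ℝ, ContDiff ℝ 2 f → HasCompactSupport f →
      ∫ p, lorenzGenX σ ρ γ1 f p ∂μ = 0)
    (hy : ∀ᵐ p : ℝ × ℝ × ℝ ∂μ, p.2.1 = 0) :
    μ.map Prod.fst = gaussianReal 0 (Real.toNNReal (γ1 / σ)) := by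
  set v := Real.toNNReal (γ1 / σ) with hv
  have hvr : (v : ℝ) = γ1 / σ := Real.coe_toNNReal _ (by positivity)
  have hv0 : v ≠ 0 := by
    rw [← NNReal.coe_ne_zero, hvr]
    positivity
  have hνprob : IsProbabilityMeasure (μ.map Prod.fst) :=
    Measure.isProbabilityMeasure_map measurable_fst.aemeasurable
  set ν := μ.map Prod.fst with hν
  have hzero : ∀ h : ℝ → ℝ, Continuous h → HasCompactSupport h →
      ∫ x, h x ∂gaussianReal 0 v = 0 → ∫ x, h x ∂ν = 0 := by
    intro h hc hs h0
    obtain ⟨g, g', hg', hgs, hgd, heq⟩ := exists_hasCompactSupport_stein_solution v hv0 hc hs h0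
    obtain ⟨φ, hφ, C, hC⟩ := exists_bounded_primitive
      (continuous_iff_continuousAt.2 fun x => (hgd x).continuousAt) hgs
    have := integral_ou_generator_eq_zero hinv hy hφ hgd hg' hgs hC
    have hpt : ∀ x, γ1 * g' x - σ * x * g x = σ * h x := by
      intro x
      rw [← heq, hvr]
      field_simp
    simp only [hpt, integral_const_mul, mul_eq_zero, hσ.ne', false_or] at this
    rwa [hν, integral_map measurable_fst.aemeasurable hc.aestronglyMeasurable]
  obtain ⟨η, hηC, hηs, hηnn, hηle, hηev⟩ := exists_cutoff
  have hηi : ∀ m : Measure ℝ, IsProbabilityMeasure m → Integrable η m := fun m _ =>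
    hηC.continuous.integrable_of_hasCompactSupport hηs
  have hpos : 0 < ∫ x, η x ∂gaussianReal 0 v := by
    rw [integral_gaussianReal_eq_integral_smul hv0]
    have hwc : Continuous (gaussianPDFReal 0 v) := continuous_iff_continuousAt.2 fun x =>
      (hasDerivAt_gaussianPDFReal_zero v hv0 x).continuousAt
    refine (hwc.mul hηC.continuous).integral_pos_of_hasCompactSupport_nonneg_nonzero
      (hηs.mul_left (f := gaussianPDFReal 0 v))
      (fun x => mul_nonneg (gaussianPDFReal_nonneg 0 v x) (hηnn _)) (x := 0) ?_
    have : η 0 = 1 := hηev.eq_of_nhds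
    simpa [this] using (gaussianPDFReal_pos 0 v 0 hv0).ne'
  set r : ℝ := (∫ x, η x ∂ν) / ∫ x, η x ∂gaussianReal 0 v with hr
  have hr0 : 0 ≤ r := div_nonneg (integral_nonneg fun _ => (hηnn _)) hpos.le
  have hext : ν = Real.toNNReal r • gaussianReal 0 v := by
    refine Measure.ext_of_integral_eq_on_compactlySupported fun f => ?_
    have hfi : ∀ m : Measure ℝ, IsProbabilityMeasure m → Integrable f m := fun m _ =>
      f.continuous.integrable_of_hasCompactSupport f.hasCompactSupport
    set t : ℝ := (∫ x, f x ∂gaussianReal 0 v) / ∫ x, η x ∂gaussianReal 0 v with ht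
    have := hzero (fun x => f x - t * η x) (f.continuous.sub (continuous_const.mul hηC.continuous))
      (f.hasCompactSupport.sub hηs.mul_left) (by
        rw [integral_sub (hfi _ inferInstance) ((hηi _ inferInstance).const_mul _),
          integral_const_mul, ht, div_mul_cancel₀ _ hpos.ne', sub_self])
    rw [integral_sub (hfi _ inferInstance) ((hηi _ inferInstance).const_mul _),
      integral_const_mul, sub_eq_zero] at this
    rw [integral_smul_nnreal_measure, this, NNReal.smul_def, Real.coe_toNNReal _ hr0, ht, hr,
      smul_eq_mul]
    ring
  have hone : Real.toNNReal r = 1 := by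
    have := congrArg (fun m : Measure ℝ => m Set.univ) hext
    simp only [Measure.smul_apply, measure_univ, ENNReal.smul_def, smul_eq_mul, mul_one] at this
    exact_mod_cast this.symm
  rw [hext, hone, one_smul]

/-- If `y = 0` almost surely then the drift of `y` vanishes almost surely. -/
lemma ae_mul_sub_eq_zero [IsProbabilityMeasure μ]
    (hinv : ∀ f : ℝ × ℝ × ℝ → ℝ, ContDiff ℝ 2 f → HasCompactSupport f →
      ∫ p, lorenzGenX σ ρ γ1 f p ∂μ = 0)
    (hy : ∀ᵐ p : ℝ × ℝ × ℝ ∂μ, p.2.1 = 0) :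
    ∀ᵐ p ∂μ, p.1 * (ρ - p.2.2) = 0 := by
  obtain ⟨η, hηC, hηs, hηnn, hηle, hηev⟩ := exists_cutoff
  have hηc : Continuous η := hηC.continuous
  have hη0 : η 0 = 1 := hηev.eq_of_nhds
  have hloc : ∀ n : ℕ, ∀ᵐ p ∂μ, (p.1 * (ρ - p.2.2)) ^ 2 *
      (η (((n : ℝ) + 1)⁻¹ * p.1) * η (((n : ℝ) + 1)⁻¹ * p.2.2)) = 0 := by
    intro n
    set e : ℝ := ((n : ℝ) + 1)⁻¹ with he
    have he0 : e ≠ 0 := by positivity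
    have hsupp := hasCompactSupport_comp_mul_left hηs he0
    have hscale : ContDiff ℝ 2 fun x => η (e * x) := hηC.comp (contDiff_const.mul contDiff_id)
    have hderiv : deriv (fun y => id y * η y) 0 = 1 := by
      refine ((hasDerivAt_id (0 : ℝ)).mul
        (hηC.differentiable (by simp) 0).hasDerivAt).deriv.trans ?_
      simp [hη0]
    have hint : ∫ p, (p.1 * (ρ - p.2.2)) ^ 2 * (η (e * p.1) * η (e * p.2.2)) ∂μ = 0 := by
      have ha : HasCompactSupport fun x => x * η (e * x) := hsupp.mul_left
      have hb : HasCompactSupport fun y => y * η y := hηs.mul_left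
      have hc : HasCompactSupport fun z => (ρ - z) * η (e * z) := hsupp.mul_left
      have := integral_lorenzGenX_tensor_eq_zero hinv hy (contDiff_id.mul hscale)
        (contDiff_id.mul hηC) ((contDiff_const.sub contDiff_id).mul hscale) ha hb hc
      rw [← this, hderiv]
      congr 1 with p
      simp only [id]
      ring
    refine (integral_eq_zero_iff_of_nonneg (fun p => ?_) ?_).1 hint
    · exact mul_nonneg (sq_nonneg _) (mul_nonneg (hηnn _) (hηnn _))
    · obtain ⟨C, hC⟩ := (show Continuous fun x => x ^ 2 * η (e * x) by
        fun_prop).bounded_above_of_compact_support hsupp.mul_left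
      obtain ⟨D, hD⟩ := (show Continuous fun z => (ρ - z) ^ 2 * η (e * z) by
        fun_prop).bounded_above_of_compact_support hsupp.mul_left
      refine Integrable.of_bound (Continuous.aestronglyMeasurable (by fun_prop)) (C * D)
        (Filter.Eventually.of_forall fun p => ?_)
      calc _ = ‖p.1 ^ 2 * η (e * p.1)‖ * ‖(ρ - p.2.2) ^ 2 * η (e * p.2.2)‖ := by
            rw [← norm_mul]; ring_nf
        _ ≤ C * D := mul_le_mul (hC _) (hD _) (norm_nonneg _) ((norm_nonneg _).trans (hC p.1))
  filter_upwards [ae_all_iff.2 hloc] with p hp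
  have hcont : Continuous fun e : ℝ =>
      (p.1 * (ρ - p.2.2)) ^ 2 * (η (e * p.1) * η (e * p.2.2)) := by fun_prop
  have hlim := (hcont.tendsto 0).comp tendsto_natCast_add_one_inv
  simp only [Function.comp_def, hp, zero_mul, hη0, mul_one] at hlim
  exact pow_eq_zero_iff two_ne_zero |>.1 (tendsto_nhds_unique hlim tendsto_const_nhds)

end InfinitesimallyInvariant

/-- for the stochastic Lorenz system with `γ₂ = γ₃ = β = 0` and
`γ₁ > 0`, any invariant probability measure `μ` (invariance expressed as
`∫ Lf dμ = 0` for all `C²` compactly supported `f`) whose `y`-marginal is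
a.s. `0` must be the product of the stationary Ornstein–Uhlenbeck Gaussian
`ν_{0,γ₁/σ}` in `x` with `δ₀` in `y` and `δ_ρ` in `z`. -/
theorem unique_invariant_measure_degenerate
    (σ ρ γ1 : ℝ) (hσ : 0 < σ) (hγ1 : 0 < γ1)
    (μ : Measure (ℝ × ℝ × ℝ)) (hμ : IsProbabilityMeasure μ)
    (hinv : ∀ f : ℝ × ℝ × ℝ → ℝ, ContDiff ℝ 2 f → HasCompactSupport f →
      ∫ p, lorenzGenX σ ρ γ1 f p ∂μ = 0)
    (hy : ∀ᵐ p : ℝ × ℝ × ℝ ∂μ, p.2.1 = 0) :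
    μ = (gaussianReal 0 (Real.toNNReal (γ1 / σ))).prod
      ((Measure.dirac (0 : ℝ)).prod (Measure.dirac ρ)) := by
  have hfst := map_fst_eq_gaussianReal hσ hγ1 hinv hy
  have hv0 : Real.toNNReal (γ1 / σ) ≠ 0 := (Real.toNNReal_pos.2 (by positivity)).ne'
  have hx : ∀ᵐ p ∂μ, p.1 ≠ 0 := by
    have := nullSingletonClass_gaussianReal (μ := 0) hv0
    refine ae_of_ae_map (p := fun x : ℝ => x ≠ 0) measurable_fst.aemeasurable ?_
    rw [hfst]
    exact Measure.ae_ne _ 0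
  have hp : (id : ℝ × ℝ × ℝ → ℝ × ℝ × ℝ) =ᵐ[μ] (fun x => (x, (0, ρ))) ∘ Prod.fst := by
    filter_upwards [hx, hy, ae_mul_sub_eq_zero hinv hy] with p h1 h2 h3
    have h4 : p.2.2 = ρ := by
      rcases mul_eq_zero.1 h3 with h | h
      · exact absurd h h1
      · linarith
    exact Prod.ext rfl (Prod.ext h2 h4)
  rw [Measure.dirac_prod_dirac, Measure.prod_dirac, ← hfst,
    Measure.map_map (by fun_prop) measurable_fst, ← Measure.map_congr hp, Measure.map_id]
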